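/- arXiv:2512.21826 — 2 statements merged into one kernel-verified Lean document; each statement's English description precedes it below -/
import Mathlib

section
/- Let (Ω, ℱ, μ) be a probability space, σ : Ω → ℝ measurable with σ > 0 almost everywhere, σ integrable with ∫ σ dμ > 0, and σ² /ρ-integrability as needed; let π ∈ (0,1]. Then (i) for every measurable ρ : Ω → ℝ with 0 < ρ ≤ 1 almost everywhere and ∫ ρ dμ ≤ π, one has ∫ σ²/ρ dμ ≥ (∫ σ dμ)²/π; and (ii) if moreover π·σ ≤ ∫ σ dμ almost everywhere, then the rule ρ₀ = π σ / (∫ σ dμ) is feasible (0 < ρ₀ ≤ 1 a.e., ∫ ρ₀ dμ = π) and attains this bound: ∫ σ²/ρ₀ dμ = (∫ σ dμ)²/π. -/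
open MeasureTheory

/-- the untruncated Cauchy–Schwarz labeling rule.
(i) Every feasible labeling rule `ρ` (with `0 < ρ ≤ 1` a.e., `E[ρ] ≤ π`, and
`σ²/ρ` integrable as needed) satisfies `∫ σ²/ρ dμ ≥ (∫ σ dμ)²/π`;
(ii) if moreover `π σ ≤ ∫ σ dμ` a.e., then `ρ₀ = π σ / ∫ σ dμ` is feasible and
attains the bound: `∫ σ²/ρ₀ dμ = (∫ σ dμ)²/π`. -/
theorem cauchy_schwarz_labeling_rule
    {Ω : Type*} [MeasurableSpace Ω] {μ : Measure Ω} [IsProbabilityMeasure μ]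
    (σ : Ω → ℝ) (hσmeas : Measurable σ) (hσpos : ∀ᵐ ω ∂μ, 0 < σ ω)
    (hσint : Integrable σ μ) (hσmean : 0 < ∫ ω, σ ω ∂μ)
    (π : ℝ) (hπ : π ∈ Set.Ioc (0:ℝ) 1) :
    (∀ ρ : Ω → ℝ, Measurable ρ → (∀ᵐ ω ∂μ, 0 < ρ ω ∧ ρ ω ≤ 1) →
      (∫ ω, ρ ω ∂μ) ≤ π → Integrable (fun ω => σ ω ^ 2 / ρ ω) μ →
      (∫ ω, σ ω ∂μ) ^ 2 / π ≤ ∫ ω, σ ω ^ 2 / ρ ω ∂μ)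
    ∧ ((∀ᵐ ω ∂μ, π * σ ω ≤ ∫ ω', σ ω' ∂μ) →
        (∀ᵐ ω ∂μ, 0 < π * σ ω / ∫ ω', σ ω' ∂μ ∧ π * σ ω / ∫ ω', σ ω' ∂μ ≤ 1)
        ∧ (∫ ω, π * σ ω / ∫ ω', σ ω' ∂μ ∂μ) = π
        ∧ (∫ ω, σ ω ^ 2 / (π * σ ω / ∫ ω', σ ω' ∂μ) ∂μ)
            = (∫ ω, σ ω ∂μ) ^ 2 / π) := by
  obtain ⟨hπ0, -⟩ := hπ
  refine ⟨fun ρ hρmeas hρ hρπ hint => ?_, fun hle => ⟨?_, ?_, ?_⟩⟩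
  · have hρint : Integrable ρ μ := by
      refine (integrable_const (1 : ℝ)).mono' hρmeas.aestronglyMeasurable ?_
      filter_upwards [hρ] with ω hω
      rw [Real.norm_eq_abs, abs_of_pos hω.1]
      exact hω.2
    set S := ∫ ω, σ ω ∂μ with hS
    -- tangent-line bound `σ² / ρ ≥ 2 c σ - c² ρ` with `c = S / π`
    have hmono : ∫ ω, (2 * (S / π) * σ ω - (S / π) ^ 2 * ρ ω) ∂μ ≤ ∫ ω, σ ω ^ 2 / ρ ω ∂μ := by
      refine integral_mono_ae ((hσint.const_mul _).sub (hρint.const_mul _)) hint ?_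
      filter_upwards [hρ] with ω hω
      rw [le_div_iff₀ hω.1]
      nlinarith [sq_nonneg (σ ω - S / π * ρ ω)]
    rw [integral_sub (hσint.const_mul _) (hρint.const_mul _), integral_const_mul,
      integral_const_mul, ← hS] at hmono
    have hbudget : (S / π) ^ 2 * ∫ ω, ρ ω ∂μ ≤ (S / π) ^ 2 * π :=
      mul_le_mul_of_nonneg_left hρπ (sq_nonneg _)
    have hvalue : S ^ 2 / π = 2 * (S / π) * S - (S / π) ^ 2 * π := by
      field_simp
      ring
    linarith
  · filter_upwards [hσpos, hle] with ω hω hωle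
    exact ⟨by positivity, (div_le_one hσmean).2 hωle⟩
  · rw [integral_div, integral_const_mul, mul_div_cancel_right₀ _ hσmean.ne']
  · set S := ∫ ω, σ ω ∂μ with hS
    have hcongr : (fun ω => σ ω ^ 2 / (π * σ ω / S)) =ᵐ[μ] fun ω => S / π * σ ω := by
      filter_upwards [hσpos] with ω hω
      field_simp
    rw [integral_congr_ae hcongr, integral_const_mul, ← hS]
    ring
end

section
/- Let (Ω, ℱ, μ) be a probability space, σ : Ω → ℝ measurable, nonnegative and integrable, and let π ∈ (0,1) with π < μ({σ > 0}). Then there exists c* > 0 such that ∫ min(σ/c*, 1) dμ = π. (The map c ↦ ∫ min(σ/c, 1) dμ is continuous and nonincreasing on (0,∞), tends to μ({σ > 0}) as c → 0⁺ and to 0 as c → ∞, so the budget-matching threshold c* exists by the intermediate value theorem.) -/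
open MeasureTheory

open Filter Topology

section

variable {Ω : Type*} [MeasurableSpace Ω] {μ : Measure Ω} {σ : Ω → ℝ}

lemma norm_min_mul_one_le {a t : ℝ} (ha : 0 ≤ a) (ht : 0 ≤ t) : ‖min (a * t) 1‖ ≤ 1 := by
  rw [Real.norm_of_nonneg (le_min (mul_nonneg ha ht) zero_le_one)]
  exact min_le_right _ _

lemma continuousOn_integral_min_mul_one [IsFiniteMeasure μ] (hσ : Measurable σ)
    (hσ0 : ∀ ω, 0 ≤ σ ω) :
    ContinuousOn (fun t : ℝ => ∫ ω, min (σ ω * t) 1 ∂μ) (Set.Ici 0) := by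
  refine continuousOn_of_dominated (bound := fun _ => 1) (fun t _ => ?_)
    (fun t ht => .of_forall fun ω => norm_min_mul_one_le (hσ0 ω) ht)
    (integrable_const _) (.of_forall fun ω => by fun_prop)
  exact ((hσ.mul_const t).min measurable_const).aestronglyMeasurable

lemma tendsto_integral_min_mul_one [IsFiniteMeasure μ] (hσ : Measurable σ)
    (hσ0 : ∀ ω, 0 ≤ σ ω) :
    Tendsto (fun t : ℝ => ∫ ω, min (σ ω * t) 1 ∂μ) atTop (𝓝 (μ.real {ω | 0 < σ ω})) := by
  have hs : MeasurableSet {ω | 0 < σ ω} := measurableSet_lt measurable_const hσ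
  rw [← integral_indicator_one hs]
  refine tendsto_integral_filter_of_dominated_convergence (fun _ => 1)
    (.of_forall fun t => ((hσ.mul_const t).min measurable_const).aestronglyMeasurable)
    ?_ (integrable_const _) (.of_forall fun ω => ?_)
  · filter_upwards [eventually_ge_atTop 0] with t ht
    exact .of_forall fun ω => norm_min_mul_one_le (hσ0 ω) ht
  · rcases (hσ0 ω).eq_or_lt with h | h
    · simp [← h]
    · have hω : ω ∈ {ω | 0 < σ ω} := h
      rw [Set.indicator_of_mem hω]
      refine tendsto_const_nhds.congr' ?_
      filter_upwards [(tendsto_id.const_mul_atTop h).eventually_ge_atTop 1] with t ht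
      exact (min_eq_right ht).symm

end

/-- existence of the budget-matching threshold `c*`.
For `σ ≥ 0` integrable and `π ∈ (0,1)` with `π < μ({σ > 0})`, there exists
`c* > 0` with `∫ min(σ/c*, 1) dμ = π`. -/
theorem exists_budget_threshold
    {Ω : Type*} [MeasurableSpace Ω] {μ : Measure Ω} [IsProbabilityMeasure μ]
    (σ : Ω → ℝ) (hσmeas : Measurable σ) (hσnn : ∀ ω, 0 ≤ σ ω)
    (hσint : Integrable σ μ)
    (π : ℝ) (hπ : π ∈ Set.Ioo (0:ℝ) 1)
    (hπlt : ENNReal.ofReal π < μ {ω | 0 < σ ω}) :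
    ∃ c : ℝ, 0 < c ∧ ∫ ω, min (σ ω / c) 1 ∂μ = π := by
  have hlt : π < μ.real {ω | 0 < σ ω} :=
    (ENNReal.ofReal_lt_iff_lt_toReal hπ.1.le (measure_ne_top _ _)).1 hπlt
  obtain ⟨T, hT, hT0⟩ := (((tendsto_integral_min_mul_one hσmeas hσnn).eventually_const_lt
    hlt).and (eventually_ge_atTop 0)).exists
  obtain ⟨t, ht, htπ⟩ := intermediate_value_Icc hT0
    ((continuousOn_integral_min_mul_one (μ := μ) hσmeas hσnn).mono Set.Icc_subset_Ici_self)
    (show π ∈ Set.Icc _ _ from ⟨by simpa using hπ.1.le, hT.le⟩)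
  have ht0 : t ≠ 0 := by
    rintro rfl
    exact hπ.1.ne (by simpa using htπ)
  exact ⟨t⁻¹, inv_pos.2 (ht.1.lt_of_ne' ht0), by simpa only [div_inv_eq_mul] using htπ⟩
end
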